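/- The vector lattice Lip(ℝ) of Lipschitz functions satisfies condition (R): for every sequence (f_k) of functions f_k : ℝ → ℝ, each Lipschitz (i.e., LipschitzWith K_k f_k for some K_k ≥ 0), there exist strictly positive reals λ_k and a Lipschitz function g : ℝ → ℝ such that λ_k·|f_k(x)| ≤ g(x) for all k and all x ∈ ℝ. -/

import Mathlib

/-- The vector lattice of Lipschitz functions on `ℝ` satisfies condition (R):
any sequence of Lipschitz functions, rescaled by suitable strictly positive
scalars, is dominated by a single Lipschitz function. -/
theorem lip_conditionR (f : ℕ → ℝ → ℝ) (K : ℕ → NNReal)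
    (hf : ∀ k, LipschitzWith (K k) (f k)) :
    ∃ lam : ℕ → ℝ, (∀ k, 0 < lam k) ∧
      ∃ g : ℝ → ℝ, (∃ Kg : NNReal, LipschitzWith Kg g) ∧
        ∀ k, ∀ x : ℝ, lam k * |f k x| ≤ g x := by
  have hpos : ∀ k, 0 < 1 + (K k : ℝ) + |f k 0| := fun k => by positivity
  refine ⟨fun k => (1 + (K k : ℝ) + |f k 0|)⁻¹, fun k => inv_pos.mpr (hpos k),
    fun x => 1 + |x|, ⟨1, ?_⟩, ?_⟩
  · refine LipschitzWith.of_dist_le_mul fun x y => ?_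
    rw [Real.dist_eq, Real.dist_eq, NNReal.coe_one, one_mul, add_sub_add_left_eq_sub]
    exact abs_abs_sub_abs_le x y
  · intro k x
    have h := (hf k).dist_le_mul x 0
    rw [Real.dist_eq, Real.dist_eq, sub_zero] at h
    have h2 := abs_sub_abs_le_abs_sub (f k x) (f k 0)
    have hK : 0 ≤ (K k : ℝ) := (K k).2
    have h0 := abs_nonneg (f k 0)
    have hx := abs_nonneg x
    show (1 + (K k : ℝ) + |f k 0|)⁻¹ * |f k x| ≤ 1 + |x|
    rw [inv_mul_le_iff₀ (hpos k)]
    nlinarith [mul_nonneg h0 hx]
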